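/- arXiv:1801.00299 — 2 statements merged into one kernel-verified Lean document; each statement's English description precedes it below -/
import Mathlib

section
/- Let N ≥ 1, let S be an invertible 2N×2N complex matrix with S K S† = K, let λ₁,…,λ_N be real numbers with λ_k ≥ 1 for all k, let D := diag(λ₁,…,λ_N,λ₁,…,λ_N), and set σ := S D S†. Then the matrix conj(σ) ⊗ σ − K ⊗ K is invertible if and only if λ_k > 1 for every k ∈ {1,…,N}. -/
open Matrix Kronecker BigOperators Finset

noncomputable section

abbrev Idx (N : ℕ) := Fin N ⊕ Fin N

/-- The complex-form symplectic form `K = [[I, 0], [0, -I]]`. -/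
def Km (N : ℕ) : Matrix (Idx N) (Idx N) ℂ := Matrix.fromBlocks 1 0 0 (-1)

/-- Entrywise complex conjugate of a matrix. -/
def mconj {m n : Type*} (A : Matrix m n ℂ) : Matrix m n ℂ := A.map (starRingEnd ℂ)

theorem mconj_mul {l m n : Type*} [Fintype m] (A : Matrix l m ℂ) (B : Matrix m n ℂ) :
    mconj (A * B) = mconj A * mconj B :=
  Matrix.map_mul

theorem mconj_Km (N : ℕ) : mconj (Km N) = Km N := by
  ext i j
  rcases i with i | i <;> rcases j with j | j <;> simp [mconj, Km, Matrix.one_apply, apply_ite]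

theorem Km_eq_diagonal (N : ℕ) :
    Km N = Matrix.diagonal (Sum.elim (fun _ => (1 : ℂ)) (fun _ => (-1 : ℂ))) := by
  rw [← Matrix.fromBlocks_diagonal, Km]
  congr 1
  rw [← Matrix.diagonal_one, Matrix.diagonal_neg]

/-- Invertibility of `conj(S D Sᴴ) ⊗ S D Sᴴ - K ⊗ K` is unchanged when `S` is removed by
congruence. -/
theorem isUnit_kronecker_sub_iff {N : ℕ} {S : Matrix (Idx N) (Idx N) ℂ} (hS : IsUnit S)
    (hsymp : S * Km N * Sᴴ = Km N) (D : Matrix (Idx N) (Idx N) ℂ) :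
    IsUnit (mconj (S * D * Sᴴ) ⊗ₖ (S * D * Sᴴ) - Km N ⊗ₖ Km N) ↔
      IsUnit (mconj D ⊗ₖ D - Km N ⊗ₖ Km N) := by
  have hconj : ∀ A : Matrix (Idx N) (Idx N) ℂ, IsUnit A → IsUnit (mconj A) :=
    fun A hA => hA.map (starRingEnd ℂ).mapMatrix
  have hSH : IsUnit Sᴴ := hS.star
  have hK : mconj S * Km N * mconj Sᴴ = Km N := by
    have h := congrArg mconj hsymp
    rwa [mconj_mul, mconj_mul, mconj_Km] at h
  have hfactor : mconj (S * D * Sᴴ) ⊗ₖ (S * D * Sᴴ) - Km N ⊗ₖ Km N =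
      (mconj S ⊗ₖ S) * (mconj D ⊗ₖ D - Km N ⊗ₖ Km N) * (mconj Sᴴ ⊗ₖ Sᴴ) := by
    rw [mul_sub, sub_mul]
    simp only [← Matrix.mul_kronecker_mul, hK, hsymp, mconj_mul]
  have hkron : ∀ A B : Matrix (Idx N) (Idx N) ℂ, IsUnit A → IsUnit B → IsUnit (A ⊗ₖ B) := by
    intro A B hA hB
    rw [Matrix.isUnit_iff_isUnit_det] at *
    rw [Matrix.det_kronecker]
    exact (hA.pow _).mul (hB.pow _)
  obtain ⟨u, hu⟩ := hkron _ _ (hconj S hS) hS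
  obtain ⟨v, hv⟩ := hkron _ _ (hconj Sᴴ hSH) hSH
  rw [hfactor, ← hu, ← hv, Units.isUnit_mul_units, Units.isUnit_units_mul]

theorem stmt11 (N : ℕ) (hN : 1 ≤ N)
    (S : Matrix (Idx N) (Idx N) ℂ) (hS : IsUnit S)
    (hsymp : S * Km N * Sᴴ = Km N)
    (lam : Fin N → ℝ) (hlam : ∀ k, 1 ≤ lam k) :
    let D : Matrix (Idx N) (Idx N) ℂ :=
      Matrix.diagonal (Sum.elim (fun k => (lam k : ℂ)) (fun k => (lam k : ℂ)))
    let σ := S * D * Sᴴ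
    IsUnit (mconj σ ⊗ₖ σ - Km N ⊗ₖ Km N) ↔ ∀ k, 1 < lam k := by
  intro D σ
  have hD : mconj D = D := by
    rw [mconj, Matrix.diagonal_map (map_zero _)]
    congr 1
    ext i
    rcases i with i | i <;> simp
  rw [isUnit_kronecker_sub_iff hS hsymp, hD, Km_eq_diagonal, Matrix.diagonal_kronecker_diagonal,
    Matrix.diagonal_kronecker_diagonal, Matrix.diagonal_sub, Matrix.isUnit_diagonal,
    Pi.isUnit_iff]
  simp only [isUnit_iff_ne_zero]
  constructor
  · intro h k
    refine lt_of_le_of_ne (hlam k) fun hk => h (Sum.inl k, Sum.inl k) ?_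
    simp [← hk]
  · intro h
    have hpos : ∀ k l, 1 < lam k * lam l := fun k l => by nlinarith [h k, h l]
    rintro ⟨i | i, j | j⟩ h0 <;>
      simp only [Sum.elim_inl, Sum.elim_inr] at h0 <;>
      norm_cast at h0 <;>
      norm_num at h0 <;>
      linarith [hpos i j]
end
end

section
/- Let N ≥ 1 and let σ be a 2N×2N Hermitian complex matrix with (Kσ)² = I. Let V be a 2N×2N Hermitian matrix satisfying (Kσ)(KV) + (KV)(Kσ) = 0, and let ν be a real number. Then the matrix X := −(1+ν²)⁻¹ · K V K satisfies ν² σ X σ − K X K = V. In particular, for ν = 1, X = −(1/2) K V K satisfies σ X σ − K X K = V. -/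
open Matrix BigOperators

noncomputable section

/-- If `k` is an involution, `k * s` squares to one and `k * v` anticommutes with `k * s`,
then conjugating `v` by `k` and multiplying by `s` on both sides negates `v`. -/
theorem mul_conj_mul_eq_neg {R : Type*} [Ring R] {k s v : R} (hk : k * k = 1)
    (hs : (k * s) ^ 2 = 1) (hanti : (k * s) * (k * v) + (k * v) * (k * s) = 0) :
    s * (k * v * k) * s = -v := by
  have h : s * k * v = -(v * k * s) := by
    rw [← sub_eq_zero, sub_neg_eq_add]
    calc s * k * v + v * k * s
        = (k * k) * (s * k * v + v * k * s) := by rw [hk, one_mul]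
      _ = k * ((k * s) * (k * v) + (k * v) * (k * s)) := by noncomm_ring
      _ = 0 := by rw [hanti, mul_zero]
  calc s * (k * v * k) * s = (s * k * v) * k * s := by noncomm_ring
    _ = -(v * (k * s) ^ 2) := by rw [h]; noncomm_ring
    _ = -v := by rw [hs, mul_one]

theorem conj_conj_of_mul_self_eq_one {R : Type*} [Monoid R] {k : R} (hk : k * k = 1) (v : R) :
    k * (k * v * k) * k = v := by
  calc k * (k * v * k) * k = (k * k) * v * (k * k) := by simp only [mul_assoc]
    _ = v := by rw [hk, one_mul, mul_one]

theorem Km_mul_self (N : ℕ) : Km N * Km N = 1 := by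
  simp [Km, Matrix.fromBlocks_multiply]

theorem stmt13 (N : ℕ) (hN : 1 ≤ N)
    (σ : Matrix (Idx N) (Idx N) ℂ) (hσ : σ.IsHermitian)
    (hpure : (Km N * σ) ^ 2 = 1)
    (V : Matrix (Idx N) (Idx N) ℂ) (hV : V.IsHermitian)
    (hanti : (Km N * σ) * (Km N * V) + (Km N * V) * (Km N * σ) = 0)
    (ν : ℝ) :
    (let X : Matrix (Idx N) (Idx N) ℂ :=
      (-(1 + (ν : ℂ)^2)⁻¹) • (Km N * V * Km N)
    ((ν : ℂ)^2) • (σ * X * σ) - Km N * X * Km N = V) ∧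
    (let X₁ : Matrix (Idx N) (Idx N) ℂ := (-(1/2 : ℂ)) • (Km N * V * Km N)
    σ * X₁ * σ - Km N * X₁ * Km N = V) := by
  have h₁ := mul_conj_mul_eq_neg (Km_mul_self N) hpure hanti
  have h₂ := conj_conj_of_mul_self_eq_one (Km_mul_self N) V
  have hν : (1 + (ν : ℂ) ^ 2) ≠ 0 := by
    have : (1 + ν ^ 2 : ℝ) ≠ 0 := by positivity
    exact_mod_cast this
  constructor <;> dsimp only <;>
    simp only [Matrix.mul_smul, Matrix.smul_mul, h₁, h₂] <;>
    match_scalars <;> field_simp <;> ring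
end
end
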